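/- Let m ≥ 3, let η be the Minkowski bilinear form on ℝ^m, let W be a finite-dimensional real inner product space and A : ℝ^m →ₗ[ℝ] W a linear map; let f, e, T be the first fundamental form, energy density, and energy-momentum tensor built from η and A. Let l, n ∈ ℝ^m satisfy η(l,l) = 0, η(n,n) = 0, η(l,n) = 1. Then T(l,n) ≥ 0; moreover T(l,n) = 0 if and only if T(u,l) = T(l,l)·η(n,u) for all u ∈ ℝ^m. -/

import Mathlib

open scoped InnerProductSpace

noncomputable section

/-- The Minkowski bilinear form of signature `(+,-,...,-)` on `ℝ^m`:
`η(u,w) = u 0 * w 0 - ∑_{i=1}^{m-1} u i * w i`. -/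
def mink (m : ℕ) (u w : Fin m → ℝ) : ℝ :=
  ∑ i : Fin m, if i.val = 0 then u i * w i else -(u i * w i)

/-- The standard basis of `ℝ^m`. -/
def stdb (m : ℕ) (a : Fin m) : Fin m → ℝ := Pi.single a 1

variable {W : Type*} [NormedAddCommGroup W] [InnerProductSpace ℝ W] [FiniteDimensional ℝ W]

/-- The first fundamental form `f(u,w) = ⟪A u, A w⟫` built from the differential `A = dφ`. -/
def firstFF {m : ℕ} (A : (Fin m → ℝ) →ₗ[ℝ] W) (u w : Fin m → ℝ) : ℝ := ⟪A u, A w⟫_ℝ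

/-- The energy density `e = (1/2)·(f(e₀,e₀) - ∑_{i=1}^{m-1} f(eᵢ,eᵢ))`, the η-trace of `f`. -/
def energyDens (m : ℕ) [NeZero m] (A : (Fin m → ℝ) →ₗ[ℝ] W) : ℝ :=
  (1 / 2) * (firstFF A (stdb m 0) (stdb m 0) -
    ∑ i ∈ Finset.univ.erase (0 : Fin m), firstFF A (stdb m i) (stdb m i))

/-- The energy-momentum tensor `T(u,w) = f(u,w) - e·η(u,w)`. -/
def emTensor (m : ℕ) [NeZero m] (A : (Fin m → ℝ) →ₗ[ℝ] W) (u w : Fin m → ℝ) : ℝ :=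
  firstFF A u w - energyDens m A * mink m u w

theorem mink_succ {k : ℕ} (u w : Fin (k + 1) → ℝ) :
    mink (k + 1) u w = u 0 * w 0 - ∑ i : Fin k, u i.succ * w i.succ := by
  simp [mink, Fin.sum_univ_succ, sub_eq_add_neg]

theorem mink_comm (m : ℕ) (u w : Fin m → ℝ) : mink m u w = mink m w u := by
  simp only [mink, mul_comm]

theorem map_eq_sum_stdb_succ {k : ℕ} (A : (Fin (k + 1) → ℝ) →ₗ[ℝ] W) (u : Fin (k + 1) → ℝ) :
    A u = u 0 • A (stdb (k + 1) 0) + ∑ i : Fin k, u i.succ • A (stdb (k + 1) i.succ) := by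
  conv_lhs => rw [pi_eq_sum_univ' u]
  simp [Fin.sum_univ_succ, stdb, map_sum, Pi.single]

theorem energyDens_succ {k : ℕ} (A : (Fin (k + 1) → ℝ) →ₗ[ℝ] W) :
    energyDens (k + 1) A = (1 / 2) * (‖A (stdb (k + 1) 0)‖ ^ 2 -
      ∑ i : Fin k, ‖A (stdb (k + 1) i.succ)‖ ^ 2) := by
  have h := Finset.add_sum_erase Finset.univ
    (fun i => firstFF A (stdb (k + 1) i) (stdb (k + 1) i)) (Finset.mem_univ 0)
  rw [Fin.sum_univ_succ] at h
  rw [energyDens, add_left_cancel h]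
  simp only [firstFF, real_inner_self_eq_norm_sq]

/-- The expansion of `∑ i, ‖xᵢ + pᵢ a + qᵢ b‖²`. -/
theorem sum_norm_add_smul_add_smul_sq {ι V : Type*} [Fintype ι] [NormedAddCommGroup V]
    [InnerProductSpace ℝ V] (x : ι → V) (p q : ι → ℝ) (a b : V) :
    ∑ i, ‖x i + p i • a + q i • b‖ ^ 2 =
      ∑ i, ‖x i‖ ^ 2 + (∑ i, p i * p i) * ‖a‖ ^ 2 + (∑ i, q i * q i) * ‖b‖ ^ 2 +
        2 * ⟪∑ i, p i • x i, a⟫_ℝ + 2 * ⟪∑ i, q i • x i, b⟫_ℝ +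
        2 * (∑ i, p i * q i) * ⟪a, b⟫_ℝ := by
  simp only [sum_inner, Finset.mul_sum, Finset.sum_mul, ← Finset.sum_add_distrib]
  refine Finset.sum_congr rfl fun i _ => ?_
  simp only [← real_inner_self_eq_norm_sq, inner_add_left, inner_add_right, real_inner_smul_left,
    real_inner_smul_right, real_inner_comm a (x i), real_inner_comm b (x i), real_inner_comm a b]
  ring

/-- A null vector that pairs nontrivially with some vector has nonzero time component. -/
theorem time_ne_zero_of_null {k : ℕ} {l n : Fin (k + 1) → ℝ} (hnn : mink (k + 1) n n = 0)
    (hln : mink (k + 1) l n = 1) : n 0 ≠ 0 := by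
  intro h0
  rw [mink_succ, h0] at hnn hln
  have hs : ∑ i : Fin k, n i.succ * n i.succ = 0 := by linarith
  rw [Finset.sum_eq_zero_iff_of_nonneg fun i _ => mul_self_nonneg _] at hs
  have hz : ∀ i : Fin k, n i.succ = 0 := fun i => mul_self_eq_zero.mp (hs i (Finset.mem_univ i))
  simp [hz] at hln

theorem mink_stdb_zero {k : ℕ} (u : Fin (k + 1) → ℝ) :
    mink (k + 1) (stdb (k + 1) 0) u = u 0 := by
  simp [mink_succ, stdb]

theorem mink_stdb_succ {k : ℕ} (u : Fin (k + 1) → ℝ) (i : Fin k) :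
    mink (k + 1) (stdb (k + 1) i.succ) u = -u i.succ := by
  simp [mink_succ, stdb, Pi.single_apply]

/-- The projection along the null pair `l, n` onto their common `η`-orthogonal space. -/
def screenProj {k : ℕ} (l n : Fin (k + 1) → ℝ) :
    (Fin (k + 1) → ℝ) →ₗ[ℝ] (Fin (k + 1) → ℝ) where
  toFun u := u - mink (k + 1) u n • l - mink (k + 1) u l • n
  map_add' u v := by
    ext j
    simp only [mink_succ, Pi.add_apply, Pi.sub_apply, Pi.smul_apply, smul_eq_mul, add_mul,
      Finset.sum_add_distrib]
    ring
  map_smul' c u := by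
    ext j
    simp only [mink_succ, Pi.sub_apply, Pi.smul_apply, smul_eq_mul, mul_assoc, ← Finset.mul_sum,
      RingHom.id_apply]
    ring

theorem map_screenProj {k : ℕ} (A : (Fin (k + 1) → ℝ) →ₗ[ℝ] W) (l n u : Fin (k + 1) → ℝ) :
    A (screenProj l n u) = A u - mink (k + 1) u n • A l - mink (k + 1) u l • A n := by
  simp [screenProj]

/-- `2 T(l,n)` is minus the `η`-trace of `f` on the screen space. -/
theorem two_mul_emTensor_eq {k : ℕ} (A : (Fin (k + 1) → ℝ) →ₗ[ℝ] W) {l n : Fin (k + 1) → ℝ}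
    (hll : mink (k + 1) l l = 0) (hnn : mink (k + 1) n n = 0) (hln : mink (k + 1) l n = 1) :
    2 * emTensor (k + 1) A l n =
      ∑ i : Fin k, ‖A (screenProj l n (stdb (k + 1) i.succ))‖ ^ 2 -
        ‖A (screenProj l n (stdb (k + 1) 0))‖ ^ 2 := by
  have hl := eq_sub_of_add_eq' (map_eq_sum_stdb_succ A l).symm
  have hn := eq_sub_of_add_eq' (map_eq_sum_stdb_succ A n).symm
  simp only [emTensor, firstFF, energyDens_succ, hln, map_screenProj, mink_stdb_zero,
    mink_stdb_succ, neg_smul, sub_neg_eq_add]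
  rw [sum_norm_add_smul_add_smul_sq, hl, hn]
  rw [mink_succ] at hll hnn hln
  have hln' : ∑ i : Fin k, n i.succ * l i.succ = l 0 * n 0 - 1 := by
    simp only [mul_comm (n _)]
    linarith
  rw [hln', ← sub_eq_zero.mp hll, ← sub_eq_zero.mp hnn]
  simp only [← real_inner_self_eq_norm_sq, inner_sub_left, inner_sub_right, real_inner_smul_left,
    real_inner_smul_right, real_inner_comm (A l) (A n), real_inner_comm (A l) (A (stdb (k + 1) 0)),
    real_inner_comm (A n) (A (stdb (k + 1) 0))]
  ring

/-- If `B` kills the null vector `n`, the `η`-trace of its first fundamental form is, up to sign,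
a sum of squares. -/
theorem sum_sq_sub_sq_eq_of_map_null {k : ℕ} (B : (Fin (k + 1) → ℝ) →ₗ[ℝ] W)
    {n : Fin (k + 1) → ℝ} (hnn : mink (k + 1) n n = 0) (h0 : n 0 ≠ 0) (hB : B n = 0) :
    ∑ i : Fin k, ‖B (stdb (k + 1) i.succ)‖ ^ 2 - ‖B (stdb (k + 1) 0)‖ ^ 2 =
      ∑ i : Fin k, ‖B (stdb (k + 1) i.succ) + n i.succ • (n 0)⁻¹ • B (stdb (k + 1) 0)‖ ^ 2 := by
  have hs := sum_norm_add_smul_add_smul_sq (fun i : Fin k => B (stdb (k + 1) i.succ))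
    (fun i => n i.succ) (fun _ => 0) ((n 0)⁻¹ • B (stdb (k + 1) 0)) 0
  have hn := eq_sub_of_add_eq' (map_eq_sum_stdb_succ B n).symm
  rw [mink_succ] at hnn
  simp only [smul_zero, add_zero, hn, hB, zero_sub, inner_neg_left, real_inner_smul_left,
    real_inner_smul_right, real_inner_self_eq_norm_sq, norm_smul, mul_pow, inner_zero_right,
    mul_zero, Finset.sum_const_zero, zero_mul, ← sub_eq_zero.mp hnn] at hs
  rw [hs, Real.norm_eq_abs, sq_abs]
  field_simp
  ring

/-- If `B` kills two null vectors `l, n` with `η(l,n) = 1` and the `η`-trace of its first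
fundamental form vanishes, then `B = 0`. -/
theorem map_eq_zero_of_sum_sq_sub_sq_eq_zero {k : ℕ} (B : (Fin (k + 1) → ℝ) →ₗ[ℝ] W)
    {l n : Fin (k + 1) → ℝ} (hnn : mink (k + 1) n n = 0) (hln : mink (k + 1) l n = 1)
    (hBl : B l = 0) (hBn : B n = 0)
    (h : ∑ i : Fin k, ‖B (stdb (k + 1) i.succ)‖ ^ 2 - ‖B (stdb (k + 1) 0)‖ ^ 2 = 0)
    (u : Fin (k + 1) → ℝ) : B u = 0 := by
  have h0 := time_ne_zero_of_null hnn hln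
  rw [sum_sq_sub_sq_eq_of_map_null B hnn h0 hBn,
    Finset.sum_eq_zero_iff_of_nonneg fun i _ => sq_nonneg _] at h
  have hi : ∀ i : Fin k,
      B (stdb (k + 1) i.succ) = -(n i.succ • (n 0)⁻¹ • B (stdb (k + 1) 0)) := fun i =>
    eq_neg_of_add_eq_zero_left (norm_eq_zero.mp (pow_eq_zero_iff two_ne_zero |>.mp
      (h i (Finset.mem_univ i))))
  have key : ∀ v, B v = mink (k + 1) v n • (n 0)⁻¹ • B (stdb (k + 1) 0) := by
    intro v
    rw [map_eq_sum_stdb_succ B v, mink_succ, sub_smul, Finset.sum_smul, mul_smul,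
      smul_inv_smul₀ h0]
    simp only [hi, smul_neg, Finset.sum_neg_distrib, mul_smul, sub_eq_add_neg]
  have hl := key l
  rw [hBl, hln, one_smul] at hl
  rw [key u, ← hl, smul_zero]

/-- `T(l,n) ≥ 0`, and `T(l,n) = 0` iff `I_a = T(l,l)·n_a`,
i.e. `T(u,l) = T(l,l)·η(n,u)` for all `u`. -/
theorem stmt9 (m : ℕ) [NeZero m] (hm : 3 ≤ m)
    (A : (Fin m → ℝ) →ₗ[ℝ] W) (l n : Fin m → ℝ)
    (hll : mink m l l = 0) (hnn : mink m n n = 0) (hln : mink m l n = 1) :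
    0 ≤ emTensor m A l n ∧
      (emTensor m A l n = 0 ↔
        ∀ u : Fin m → ℝ, emTensor m A u l = emTensor m A l l * mink m n u) := by
  obtain ⟨k, rfl⟩ : ∃ k, m = k + 1 := ⟨m - 1, by omega⟩
  have hnl : mink (k + 1) n l = 1 := by rw [mink_comm, hln]
  let B := A ∘ₗ screenProj l n
  have hBl : B l = 0 := by simp [B, map_screenProj, hll, hln]
  have hBn : B n = 0 := by simp [B, map_screenProj, hnn, hnl]
  have hT : 2 * emTensor (k + 1) A l n =
      ∑ i : Fin k, ‖B (stdb (k + 1) i.succ)‖ ^ 2 - ‖B (stdb (k + 1) 0)‖ ^ 2 :=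
    two_mul_emTensor_eq A hll hnn hln
  refine ⟨?_, fun h u => ?_, fun h => ?_⟩
  · rw [sum_sq_sub_sq_eq_of_map_null B hnn (time_ne_zero_of_null hnn hln) hBn] at hT
    have : 0 ≤ 2 * emTensor (k + 1) A l n := hT ▸ Finset.sum_nonneg fun i _ => sq_nonneg _
    linarith
  · have hu : B u = 0 :=
      map_eq_zero_of_sum_sq_sub_sq_eq_zero B hnn hln hBl hBn (by rw [← hT, h, mul_zero]) u
    have hAu : A u = mink (k + 1) u n • A l + mink (k + 1) u l • A n := by
      rw [← sub_eq_zero, ← sub_sub, ← map_screenProj]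
      exact hu
    simp only [emTensor, firstFF, hln, hll, mink_comm _ n u] at h ⊢
    rw [hAu, inner_add_left, real_inner_smul_left, real_inner_smul_left,
      real_inner_comm (A l) (A n)]
    linear_combination mink (k + 1) u l * h
  · have hn := h n
    rw [hnn, mul_zero] at hn
    rw [← hn, emTensor, emTensor, mink_comm _ l n, firstFF, firstFF, real_inner_comm]
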